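/- arXiv:2512.06386 — 2 statements merged into one kernel-verified Lean document; each statement's English description precedes it below -/
import Mathlib

section
/- Let p be a prime number. The field 𝔽_p((t)) of formal Laurent series over the field with p elements, equipped with its t-adic valuation v_t (whose valuation ring is 𝔽_p[[t]]), is an extremal valued field: for every n ≥ 1 and every polynomial f ∈ 𝔽_p((t))[X₁,…,Xₙ], the set {v_t(f(a₁,…,aₙ)) : a₁,…,aₙ ∈ 𝔽_p[[t]]} ⊆ ℤ ∪ {∞} has a maximal element. -/
open MvPolynomial
open scoped Classical

/-- The `t`-adic valuation `v_t` on the field `𝔽_p((t))` of formal Laurent series, with values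
in `ℤ ∪ {∞}`: `v_t f` is the order of the first nonzero coefficient of `f`, and `v_t 0 = ∞`.
Its valuation ring is the power series ring `𝔽_p[[t]] = {f | 0 ≤ v_t f}`. -/
noncomputable def tAdicVal (p : ℕ) [Fact p.Prime] (f : LaurentSeries (ZMod p)) : WithTop ℤ :=
  if f = 0 then ⊤ else (f.order : WithTop ℤ)

theorem tAdicVal_eq_orderTop (p : ℕ) [Fact p.Prime] (f : LaurentSeries (ZMod p)) :
    tAdicVal p f = f.orderTop := by
  by_cases hf : f = 0
  · simp [tAdicVal, hf]
  · simp [tAdicVal, hf, HahnSeries.order_eq_orderTop_of_ne_zero hf]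

/-- A Laurent series of nonnegative order is a power series. -/
theorem LaurentSeries.exists_powerSeries_of_zero_le_orderTop {R : Type*} [Semiring R]
    {f : LaurentSeries R} (hf : 0 ≤ f.orderTop) :
    ∃ g : PowerSeries R, (g : LaurentSeries R) = f := by
  refine ⟨PowerSeries.mk fun n => f.coeff n, ?_⟩
  ext i
  rw [PowerSeries.coeff_coe]
  split_ifs with hi
  · exact (HahnSeries.coeff_eq_zero_of_lt_orderTop
      (lt_of_lt_of_le (by exact_mod_cast hi) hf)).symm
  · rw [PowerSeries.coeff_mk, Int.natAbs_of_nonneg (not_lt.mp hi)]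

theorem PowerSeries.zero_le_orderTop_coe {R : Type*} [Semiring R] (x : PowerSeries R) :
    0 ≤ (x : LaurentSeries R).orderTop := by
  rw [HahnSeries.le_orderTop_iff_forall]
  intro i hi
  rw [PowerSeries.coeff_coe, if_pos (by exact_mod_cast hi)]

theorem PowerSeries.orderTop_coe_le_of_order_le {R : Type*} [Semiring R] {x y : PowerSeries R}
    (h : x.order ≤ y.order) :
    (x : LaurentSeries R).orderTop ≤ (y : LaurentSeries R).orderTop := by
  rw [HahnSeries.le_orderTop_iff_forall]
  intro i hi
  rw [PowerSeries.coeff_coe]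
  split_ifs with hneg
  · rfl
  by_contra hy
  have hx := h.trans (PowerSeries.order_le _ hy)
  have hx0 : x ≠ 0 := by
    rintro rfl
    simp at hx
  have hle : (x : LaurentSeries R).orderTop ≤ ((x.order.toNat : ℤ) : WithTop ℤ) := by
    apply HahnSeries.orderTop_le_of_coeff_ne_zero
    rw [LaurentSeries.coeff_coe_powerSeries]
    exact PowerSeries.coeff_order hx0
  have hlt := hi.trans_le hle
  rw [WithTop.coe_lt_coe] at hlt
  have := ENat.toNat_le_of_le_natCast hx
  omega

/-- Denominators of a polynomial over the fraction field can be cleared. -/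
theorem MvPolynomial.exists_map_algebraMap_eq_C_mul {σ A K : Type*} [CommRing A] [IsDomain A]
    [Field K] [Algebra A K] [IsFractionRing A K] (f : MvPolynomial σ K) :
    ∃ c : A, c ≠ 0 ∧ ∃ g : MvPolynomial σ A,
      MvPolynomial.map (algebraMap A K) g = C (algebraMap A K c) * f := by
  induction f using MvPolynomial.induction_on with
  | C a =>
    obtain ⟨x, y, hy, rfl⟩ := IsFractionRing.div_surjective (A := A) a
    refine ⟨y, nonZeroDivisors.ne_zero hy, C x, ?_⟩
    have : algebraMap A K y ≠ 0 := IsFractionRing.to_map_ne_zero_of_mem_nonZeroDivisors hy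
    rw [map_C, ← C_mul, mul_div_cancel₀ _ this]
  | add f₁ f₂ h₁ h₂ =>
    obtain ⟨c₁, hc₁, g₁, hg₁⟩ := h₁
    obtain ⟨c₂, hc₂, g₂, hg₂⟩ := h₂
    refine ⟨c₁ * c₂, mul_ne_zero hc₁ hc₂, C c₂ * g₁ + C c₁ * g₂, ?_⟩
    simp only [map_add, map_mul, map_C, hg₁, hg₂]
    ring
  | mul_X f i h =>
    obtain ⟨c, hc, g, hg⟩ := h
    refine ⟨c, hc, g * X i, ?_⟩
    rw [map_mul, map_X, hg, mul_assoc]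

open scoped PowerSeries.WithPiTopology in
theorem PowerSeries.upperSemicontinuous_order {R : Type*} [Semiring R] [TopologicalSpace R]
    [T1Space R] : UpperSemicontinuous (PowerSeries.order : PowerSeries R → ℕ∞) := by
  intro x c hx
  have hx0 : x ≠ 0 := by
    rintro rfl
    simp at hx
  have hnhds : ∀ᶠ y in nhds x, PowerSeries.coeff x.order.toNat y ≠ 0 :=
    (PowerSeries.WithPiTopology.continuous_coeff R _).continuousAt.eventually_ne
      (PowerSeries.coeff_order hx0)
  filter_upwards [hnhds] with y hy
  refine (PowerSeries.order_le _ hy).trans_lt ?_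
  rwa [ENat.natCast_toNat (by simpa using hx0)]

open scoped PowerSeries.WithPiTopology in
/-- Over a finite ring, the order of the values of a polynomial on power series is maximal
somewhere. -/
theorem PowerSeries.exists_forall_order_eval_le {R σ : Type*} [CommRing R] [Finite R]
    (g : MvPolynomial σ (PowerSeries R)) :
    ∃ a : σ → PowerSeries R, ∀ b : σ → PowerSeries R, (eval b g).order ≤ (eval a g).order := by
  let _ : TopologicalSpace R := ⊥
  have : DiscreteTopology R := ⟨rfl⟩
  have : CompactSpace (PowerSeries R) := inferInstanceAs (CompactSpace ((Unit →₀ ℕ) → R))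
  have husc : UpperSemicontinuous fun a : σ → PowerSeries R => (eval a g).order :=
    PowerSeries.upperSemicontinuous_order.comp (MvPolynomial.continuous_eval g)
  obtain ⟨a, -, ha⟩ := (husc.upperSemicontinuousOn Set.univ).exists_isMaxOn
    Set.univ_nonempty isCompact_univ
  exact ⟨a, fun b => ha (Set.mem_univ b)⟩

/-- `(𝔽_p((t)), v_t)` is an extremal valued field: for every `n ≥ 1` and every polynomial
`f ∈ 𝔽_p((t))[X₁,…,Xₙ]`, the set `{v_t (f (a₁,…,aₙ)) : a₁,…,aₙ ∈ 𝔽_p[[t]]} ⊆ ℤ ∪ {∞}`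
has a maximal element. -/
theorem laurentSeries_isExtremal (p : ℕ) [Fact p.Prime]
    (n : ℕ) (hn : 1 ≤ n) (f : MvPolynomial (Fin n) (LaurentSeries (ZMod p))) :
    ∃ a : Fin n → LaurentSeries (ZMod p), (∀ i, 0 ≤ tAdicVal p (a i)) ∧
      ∀ b : Fin n → LaurentSeries (ZMod p), (∀ i, 0 ≤ tAdicVal p (b i)) →
        tAdicVal p (eval b f) ≤ tAdicVal p (eval a f) := by
  simp only [tAdicVal_eq_orderTop]
  obtain ⟨c, hc, g, hg⟩ :=
    MvPolynomial.exists_map_algebraMap_eq_C_mul (A := PowerSeries (ZMod p)) f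
  have key : ∀ a : Fin n → PowerSeries (ZMod p),
      ((eval a g : PowerSeries (ZMod p)) : LaurentSeries (ZMod p)) =
        (c : LaurentSeries (ZMod p)) * eval (fun i => (a i : LaurentSeries (ZMod p))) f := by
    intro a
    have h := congrArg (eval fun i => (a i : LaurentSeries (ZMod p))) hg
    rw [map_mul, eval_C, eval_map] at h
    rw [← LaurentSeries.coe_algebraMap] at h ⊢
    rw [← h]
    exact eval₂_comp _ _ _
  obtain ⟨a, ha⟩ := PowerSeries.exists_forall_order_eval_le g
  refine ⟨fun i => (a i : LaurentSeries (ZMod p)),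
    fun i => PowerSeries.zero_le_orderTop_coe (a i), fun b hb => ?_⟩
  choose b' hb' using fun i => LaurentSeries.exists_powerSeries_of_zero_le_orderTop (hb i)
  obtain rfl : (fun i => (b' i : LaurentSeries (ZMod p))) = b := funext hb'
  have h := PowerSeries.orderTop_coe_le_of_order_le (ha b')
  rw [key, key, HahnSeries.orderTop_mul, HahnSeries.orderTop_mul] at h
  have hc' : (c : LaurentSeries (ZMod p)).orderTop ≠ ⊤ := by
    rw [Ne, HahnSeries.orderTop_eq_top]
    exact fun h0 => hc (HahnSeries.ofPowerSeries_injective (h0.trans (map_zero _).symm))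
  exact (WithTop.add_le_add_iff_left hc').mp h
end

section
/- Let K be a large field and F|K an algebraic function field. If there is a K-rational place of F which admits local uniformization, then K is existentially closed in F. -/
noncomputable section
universe u v

section Place
variable (k : Type u) (F : Type v) [Field k] [Field F] [Algebra k F]

/-- A `k`-rational place of `F`: a valuation ring `O` of `F` containing `k` such that the
residue map restricts to an isomorphism of `k` onto the residue field of `O`. -/
def IsKRationalPlace (O : ValuationSubring F) : Prop :=
  ∃ h : ∀ x : k, algebraMap k F x ∈ O,
    Function.Bijective (fun x : k => IsLocalRing.residue O ⟨algebraMap k F x, h x⟩)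

/-- `F|k` is a function field: a finitely generated field extension of transcendence
degree at least `1`. -/
def IsFunctionField : Prop :=
  (∃ s : Finset F, IntermediateField.adjoin k (↑s : Set F) = ⊤) ∧ ¬ Algebra.IsAlgebraic k F

end Place

section LU

/-- A Noetherian local ring is regular if its maximal ideal can be generated by
(Krull dimension)-many elements. -/
def IsRegularLocalRingP (R : Type*) [CommRing R] [IsLocalRing R] : Prop :=
  IsNoetherianRing R ∧
    ∃ s : Finset R, Ideal.span (↑s : Set R) = IsLocalRing.maximalIdeal R ∧
      (s.card : WithBot (WithTop ℕ)) = ringKrullDim R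

variable {k : Type u} {F : Type v} [Field k] [Field F] [Algebra k F]

/-- The inclusion of a subalgebra contained in a valuation subring. -/
def subalgebraToValuationSubring (A : Subalgebra k F) (O : ValuationSubring F)
    (h : ∀ a : A, (a : F) ∈ O) : A →+* O where
  toFun a := ⟨(a : F), h a⟩
  map_one' := by ext; simp
  map_mul' x y := by ext; simp
  map_zero' := by ext; simp
  map_add' x y := by ext; simp

/-- The place given by the valuation ring `O` of `F` admits local uniformization: there is a
finitely generated `k`-subalgebra `A ⊆ O` with fraction field `F` such that the localization
of `A` at the center `A ∩ m_O` is a regular local ring. -/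
def AdmitsLocalUniformization (k : Type u) (F : Type v) [Field k] [Field F] [Algebra k F]
    (O : ValuationSubring F) : Prop :=
  ∃ (A : Subalgebra k F) (h : ∀ a : A, (a : F) ∈ O), A.FG ∧
    (∀ x : F, ∃ a b : A, (b : F) ≠ 0 ∧ x = a / b) ∧
    IsRegularLocalRingP (Localization.AtPrime
      (Ideal.comap (subalgebraToValuationSubring A O h) (IsLocalRing.maximalIdeal O)))

end LU
end


section EC
universe u₁ u₂
variable (K : Type u₁) [Field K]

/-- `K` is existentially closed in the extension field `L`: every finite system of polynomial
equations and inequations over `K` having a solution in `L` has a solution in `K`. -/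
def ExistentiallyClosedIn (L : Type u₂) [Field L] [Algebra K L] : Prop :=
  ∀ (n : ℕ) (E N : Finset (MvPolynomial (Fin n) K)),
    (∃ x : Fin n → L, (∀ f ∈ E, MvPolynomial.aeval x f = 0) ∧
      (∀ g ∈ N, MvPolynomial.aeval x g ≠ 0)) →
    ∃ x : Fin n → K, (∀ f ∈ E, MvPolynomial.eval x f = 0) ∧
      (∀ g ∈ N, MvPolynomial.eval x g ≠ 0)

/-- A field `K` is large if it is existentially closed in the Laurent series field `K((t))`. -/
def IsLargeField : Prop := ExistentiallyClosedIn K (LaurentSeries K)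

end EC


open PowerSeries in
/-- If `t` is a non-zero-divisor generating the kernel of a retraction `ρ : B → K` of a
`K`-algebra `B`, expanding the elements of `B` in powers of `t` gives a homomorphism to `K⟦X⟧`. -/
theorem exists_algHom_powerSeries {K B : Type*} [Field K] [CommRing B] [IsDomain B] [Algebra K B]
    (ρ : B →ₐ[K] K) {t : B} (ht : t ≠ 0) (hker : ∀ b, ρ b = 0 ↔ t ∣ b) :
    ∃ φ : B →ₐ[K] K⟦X⟧, φ t = X ∧ ∀ b, constantCoeff (φ b) = ρ b := by
  have hdvd : ∀ b, ∃ c, b - algebraMap K B (ρ b) = t * c := fun b =>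
    (hker _).1 (by simp)
  choose D hD using hdvd
  have hDeq : ∀ {b : B} {k : K} {c : B}, b = algebraMap K B k + t * c → D b = c := by
    intro b k c h
    have ht0 : ρ t = 0 := (hker t).2 dvd_rfl
    have hk : ρ b = k := by simp [h, ht0]
    apply mul_left_cancel₀ ht
    rw [← hD, hk, h]
    ring
  have hDs : ∀ b, b = algebraMap K B (ρ b) + t * D b := fun b => by rw [← hD]; ring
  have hadd : ∀ a b, D (a + b) = D a + D b := fun a b => hDeq (k := ρ a + ρ b) (by
    conv_lhs => rw [hDs a, hDs b]
    rw [map_add]; ring)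
  have hmul : ∀ a b, D (a * b) = D a * b + algebraMap K B (ρ a) * D b := fun a b =>
    hDeq (k := ρ a * ρ b) (by
      have h1 : a * b = (algebraMap K B (ρ a) + t * D a) * b := by rw [← hDs a]
      have h2 : algebraMap K B (ρ a) * b
          = algebraMap K B (ρ a) * (algebraMap K B (ρ b) + t * D b) := by rw [← hDs b]
      rw [map_mul]; linear_combination h1 + h2)
  have halg : ∀ k, D (algebraMap K B k) = 0 := fun k => hDeq (k := k) (by simp)
  have hiter : ∀ n k, ρ (D^[n + 1] (algebraMap K B k)) = 0 := fun n k => by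
    have h0 : D 0 = 0 := by simpa using halg 0
    rw [Function.iterate_succ_apply, halg, Function.iterate_fixed h0, map_zero]
  have hiter_add : ∀ n a b, D^[n] (a + b) = D^[n] a + D^[n] b := by
    intro n
    induction n with
    | zero => simp
    | succ n ih => intro a b; simp only [Function.iterate_succ_apply, hadd, ih]
  let f : B → K⟦X⟧ := fun b => PowerSeries.mk fun n => ρ (D^[n] b)
  have hf : ∀ n b, coeff n (f b) = ρ (D^[n] b) := fun n b => by simp [f]
  have hfs : ∀ b, f b = C (ρ b) + X * f (D b) := by
    intro b
    ext n
    cases n with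
    | zero => simp [hf]
    | succ n => simp [hf, coeff_succ_X_mul]
  have hfalg : ∀ k, f (algebraMap K B k) = algebraMap K K⟦X⟧ k := by
    intro k
    ext n
    cases n with
    | zero => simp [hf]
    | succ n => rw [hf, hiter]; simp
  have hfadd : ∀ a b, f (a + b) = f a + f b := fun a b => by
    ext n; simp only [map_add, hf, hiter_add]
  have hfsmul : ∀ k b, f (algebraMap K B k * b) = C k * f b := by
    intro k b
    have hD1 : ∀ b, D (algebraMap K B k * b) = algebraMap K B k * D b := fun b => by
      rw [hmul, halg]; simp
    have hDn : ∀ n b, D^[n] (algebraMap K B k * b) = algebraMap K B k * D^[n] b := by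
      intro n
      induction n with
      | zero => simp
      | succ n ih => intro b; simp only [Function.iterate_succ_apply, hD1, ih]
    ext n
    simp [hf, hDn]
  have hfmul : ∀ a b, f (a * b) = f a * f b := by
    intro a b
    ext n
    induction n generalizing a b with
    | zero => simp [hf, coeff_mul]
    | succ n ih =>
      rw [hfs a, add_mul, mul_assoc, map_add, coeff_succ_X_mul, ← ih, hfs (a * b), map_add,
        coeff_succ_X_mul, hmul, hfadd, hfsmul, hfs b, mul_add]
      simp only [map_add, coeff_C_mul, coeff_C, coeff_succ_X_mul]
      simp
      ring
  refine ⟨{ toFun := f, map_one' := ?_, map_mul' := hfmul, map_zero' := ?_, map_add' := hfadd,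
            commutes' := hfalg }, ?_, ?_⟩
  · simpa using hfalg 1
  · simpa using hfalg 0
  · have h1 : D t = 1 := hDeq (k := 0) (by simp)
    have h2 : f 1 = 1 := by simpa using hfalg 1
    change f t = X
    rw [hfs, h1, h2, (hker t).2 dvd_rfl]
    simp
  · intro b
    change constantCoeff (f b) = ρ b
    rw [hfs]
    simp

theorem MvPolynomial.IsHomogeneous.eval_mul_left {σ R : Type*} [CommSemiring R]
    {p : MvPolynomial σ R} {n : ℕ} (hp : p.IsHomogeneous n) (t : R) (c : σ → R) :
    MvPolynomial.eval (fun i => t * c i) p = t ^ n * MvPolynomial.eval c p := by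
  rw [MvPolynomial.eval_eq, MvPolynomial.eval_eq, Finset.mul_sum]
  refine Finset.sum_congr rfl fun d hd => ?_
  have hdn : d.degree = n := by
    rw [Finsupp.degree_eq_weight_one]
    exact hp (MvPolynomial.mem_support_iff.1 hd)
  rw [Finset.prod_congr rfl fun i _ => mul_pow t (c i) (d i), Finset.prod_mul_distrib,
    Finset.prod_pow_eq_pow_sum, ← hdn, Finsupp.degree_apply]
  ring

/-- If the maximal ideal is generated by `t` and fewer elements than the Krull dimension, some
prime contains these elements but not `t`. -/
theorem exists_isPrime_of_card_lt_ringKrullDim {R : Type*} [CommRing R] [IsLocalRing R]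
    [IsNoetherianRing R] (T : Finset R) (hT : (T.card : WithBot ℕ∞) < ringKrullDim R)
    (hTm : Ideal.span (T : Set R) ≤ IsLocalRing.maximalIdeal R) {t : R}
    (hmt : IsLocalRing.maximalIdeal R ≤ Ideal.span T ⊔ Ideal.span {t}) :
    ∃ q : Ideal R, q.IsPrime ∧ Ideal.span (T : Set R) ≤ q ∧ t ∉ q := by
  by_contra! hcon
  have hmin : IsLocalRing.maximalIdeal R ∈ (Ideal.span (T : Set R)).minimalPrimes := by
    refine ⟨⟨inferInstance, hTm⟩, fun q hq _ => hmt.trans (sup_le hq.2 ?_)⟩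
    rw [Ideal.span_singleton_le_iff_mem]
    exact hcon q hq.1 hq.2
  have h := Ideal.height_le_card_of_mem_minimalPrimes_span_finset hmin
  rw [← IsLocalRing.maximalIdeal_height_eq_ringKrullDim] at hT
  exact absurd (WithBot.coe_le_coe.2 h) (not_le.2 hT)

/-- A nonzero element of a Noetherian local ring whose maximal ideal is generated by `x` is a
form in `x` with a coefficient that is a unit. -/
theorem exists_isHomogeneous_eval_eq {R K ι : Type*} [CommRing R] [IsLocalRing R]
    [IsNoetherianRing R] [Field K] (ρ : R →+* K)
    (hρ : RingHom.ker ρ = IsLocalRing.maximalIdeal R) {x : ι → R}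
    (hx : Ideal.span (Set.range x) = IsLocalRing.maximalIdeal R) {r : R} (hr : r ≠ 0) :
    ∃ (n : ℕ) (p : MvPolynomial ι R), p.IsHomogeneous n ∧ MvPolynomial.eval x p = r ∧
      MvPolynomial.map ρ p ≠ 0 := by
  classical
  have hex : ∃ n, r ∉ IsLocalRing.maximalIdeal R ^ n := by
    by_contra! h
    have hmem : r ∈ ⨅ i : ℕ, IsLocalRing.maximalIdeal R ^ i := by simpa using h
    rw [Ideal.iInf_pow_eq_bot_of_isLocalRing _
      (IsLocalRing.maximalIdeal.isMaximal R).ne_top] at hmem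
    exact hr (by simpa using hmem)
  obtain ⟨n, hn⟩ : ∃ n, Nat.find hex = n + 1 := by
    refine Nat.exists_eq_succ_of_ne_zero fun h0 => ?_
    have := Nat.find_spec hex
    rw [h0] at this
    simp at this
  have hnot : r ∉ IsLocalRing.maximalIdeal R ^ (n + 1) := hn ▸ Nat.find_spec hex
  have hmem : r ∈ IsLocalRing.maximalIdeal R ^ n := by
    by_contra h
    exact Nat.find_min hex (m := n) (by omega) h
  rw [← hx, Ideal.mem_span_pow_iff_exists_isHomogeneous] at hmem
  obtain ⟨p, hp, hpr⟩ := hmem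
  refine ⟨n, p, hp, hpr, fun h0 => hnot ?_⟩
  rw [← hpr, MvPolynomial.eval_eq, pow_succ']
  refine Ideal.sum_mem _ fun d hd => Ideal.mul_mem_mul ?_ ?_
  · rw [← hρ, RingHom.mem_ker, ← MvPolynomial.coeff_map, h0, MvPolynomial.coeff_zero]
  · have hdn : ∑ i ∈ d.support, d i = n := by
      rw [← Finsupp.degree_apply, Finsupp.degree_eq_weight_one]
      exact hp (MvPolynomial.mem_support_iff.1 hd)
    rw [← hdn, ← Finset.prod_pow_eq_pow_sum]
    refine Ideal.prod_mem_prod fun i _ => Ideal.pow_mem_pow ?_ _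
    rw [← hx]
    exact Ideal.subset_span ⟨i, rfl⟩

open PowerSeries in
/-- The nonzero elements of a regular local `K`-algebra with residue field `K` are separated
from zero by homomorphisms to `K⟦X⟧`. -/
theorem IsRegularLocalRingP.exists_algHom_powerSeries_ne_zero {K R : Type*} [Field K] [Infinite K]
    [CommRing R] [IsLocalRing R] [Algebra K R] (hR : IsRegularLocalRingP R) (ρ : R →ₐ[K] K)
    {r : R} (hr : r ≠ 0) : ∃ φ : R →ₐ[K] K⟦X⟧, φ r ≠ 0 := by
  classical
  obtain ⟨hN, s, hs, hcard⟩ := hR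
  have hρs : Function.Surjective ρ := fun k => ⟨algebraMap K R k, by simp⟩
  have hρ : RingHom.ker (ρ : R →+* K) = IsLocalRing.maximalIdeal R :=
    IsLocalRing.eq_maximalIdeal (RingHom.ker_isMaximal_of_surjective (ρ : R →+* K) hρs)
  have hρm : ∀ {a : R}, ρ a = 0 ↔ a ∈ IsLocalRing.maximalIdeal R := by
    intro a
    rw [← hρ]
    rfl
  rcases s.eq_empty_or_nonempty with rfl | ⟨x₀, hx₀⟩
  · refine ⟨(Algebra.ofId K K⟦X⟧).comp ρ, ?_⟩
    have h0 : ρ r ≠ 0 := by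
      rw [Ne, hρm, ← hs]
      simpa using hr
    simpa using h0
  let x : s → R := fun i => i
  have hx : Ideal.span (Set.range x) = IsLocalRing.maximalIdeal R := by
    rw [← hs]; simp [x]
  obtain ⟨n, p, hp, hpr, hp0⟩ := exists_isHomogeneous_eval_eq (ρ : R →+* K) hρ hx hr
  obtain ⟨c, hc⟩ : ∃ c : s → K, MvPolynomial.eval c
      (MvPolynomial.map (ρ : R →+* K) p * MvPolynomial.X ⟨x₀, hx₀⟩) ≠ 0 := by
    by_contra! h
    exact mul_ne_zero hp0 (MvPolynomial.X_ne_zero _) (MvPolynomial.funext (by simpa using h))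
  rw [map_mul, MvPolynomial.eval_X] at hc
  have hc₀ := right_ne_zero_of_mul hc
  have hcp := left_ne_zero_of_mul hc
  set i₀ : s := ⟨x₀, hx₀⟩
  let t : R := algebraMap K R (c i₀)⁻¹ * x i₀
  have hxt : x i₀ = algebraMap K R (c i₀) * t := by
    simp only [t]
    rw [← mul_assoc, ← map_mul, mul_inv_cancel₀ hc₀, map_one, one_mul]
  have hxm : ∀ i, x i ∈ IsLocalRing.maximalIdeal R := fun i => hx ▸ Ideal.subset_span ⟨i, rfl⟩
  have htm : t ∈ IsLocalRing.maximalIdeal R := Ideal.mul_mem_left _ _ (hxm i₀)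
  let T : Finset R := (Finset.univ.erase i₀).image fun i => x i - algebraMap K R (c i) * t
  have hTcard : (T.card : WithBot ℕ∞) < ringKrullDim R := by
    rw [← hcard]
    have h1 : T.card < s.card := Finset.card_image_le.trans_lt (by
      rw [← Fintype.card_coe s]
      exact Finset.card_erase_lt_of_mem (Finset.mem_univ _))
    exact Nat.cast_lt.2 h1
  have hTx : ∀ i, x i - algebraMap K R (c i) * t ∈ Ideal.span (T : Set R) := by
    intro i
    by_cases hi : i = i₀
    · rw [hi, hxt, sub_self]
      exact zero_mem _
    · exact Ideal.subset_span (Finset.mem_coe.2 (Finset.mem_image_of_mem _ (by simp [hi])))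
  obtain ⟨q, hq, hTq, htq⟩ := exists_isPrime_of_card_lt_ringKrullDim T hTcard (t := t) (by
      rw [Ideal.span_le]
      intro y hy
      obtain ⟨i, -, rfl⟩ := Finset.mem_image.1 (Finset.mem_coe.1 hy)
      exact sub_mem (hxm i) (Ideal.mul_mem_left _ _ htm)) (by
      rw [← hx, Ideal.span_le]
      rintro _ ⟨i, rfl⟩
      rw [← sub_add_cancel (x i) (algebraMap K R (c i) * t)]
      exact Submodule.add_mem_sup (hTx i)
        (Ideal.mul_mem_left _ _ (Ideal.mem_span_singleton_self t)))
  have hqm : ∀ a ∈ q, ρ a = 0 := fun a ha => hρm.2 (IsLocalRing.le_maximalIdeal hq.ne_top ha)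
  have hxq : ∀ i, Ideal.Quotient.mkₐ K q (x i) = algebraMap K (R ⧸ q) (c i) *
      Ideal.Quotient.mkₐ K q t := by
    intro i
    have h := Ideal.Quotient.eq.2 (hTq (hTx i))
    rw [map_mul] at h
    exact h
  obtain ⟨ψ, hψt, hψ⟩ := exists_algHom_powerSeries (Ideal.Quotient.liftₐ q ρ hqm)
    (t := Ideal.Quotient.mkₐ K q t) (by simpa [Ideal.Quotient.eq_zero_iff_mem] using htq) (by
      intro b
      obtain ⟨a, rfl⟩ := Ideal.Quotient.mkₐ_surjective K q b
      have hla : Ideal.Quotient.liftₐ q ρ hqm (Ideal.Quotient.mkₐ K q a) = ρ a := rfl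
      rw [hla, hρm]
      constructor
      · intro ha
        rw [← Ideal.mem_span_singleton]
        have hle : IsLocalRing.maximalIdeal R ≤
            (Ideal.span {Ideal.Quotient.mkₐ K q t}).comap (Ideal.Quotient.mkₐ K q) := by
          rw [← hx, Ideal.span_le]
          rintro _ ⟨i, rfl⟩
          rw [SetLike.mem_coe, Ideal.mem_comap, hxq]
          exact Ideal.mul_mem_left _ _ (Ideal.mem_span_singleton_self _)
        exact hle ha
      · rintro ⟨b, hb⟩
        obtain ⟨b, rfl⟩ := Ideal.Quotient.mkₐ_surjective K q b
        rw [← hρm, ← hla, hb, map_mul]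
        have : Ideal.Quotient.liftₐ q ρ hqm (Ideal.Quotient.mkₐ K q t) = ρ t := rfl
        rw [this, hρm.2 htm, zero_mul])
  let φ : R →ₐ[K] K⟦X⟧ := ψ.comp (Ideal.Quotient.mkₐ K q)
  have hφc : (constantCoeff (R := K)).comp (φ : R →+* K⟦X⟧) = (ρ : R →+* K) := by
    ext a
    exact hψ _
  have hφx : ∀ i, φ (x i) = X * C (c i) := by
    intro i
    simp only [φ, AlgHom.comp_apply]
    rw [hxq, map_mul, hψt, AlgHom.commutes, mul_comm]
    rfl
  refine ⟨φ, ?_⟩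
  have hφr : φ r = X ^ n * MvPolynomial.eval (fun i => C (c i))
      (MvPolynomial.map (φ : R →+* K⟦X⟧) p) := by
    rw [← (hp.map (φ : R →+* K⟦X⟧)).eval_mul_left, ← hpr]
    simp only [← hφx]
    rw [MvPolynomial.eval_map]
    change (φ : R →+* K⟦X⟧) (MvPolynomial.eval x p) = _
    rw [MvPolynomial.eval, MvPolynomial.coe_eval₂Hom, MvPolynomial.hom_eval₂]
    rfl
  rw [hφr]
  refine mul_ne_zero (pow_ne_zero _ X_ne_zero) fun h => hcp ?_
  have h' := congrArg (constantCoeff (R := K)) h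
  rw [MvPolynomial.eval_map, MvPolynomial.hom_eval₂, hφc, map_zero] at h'
  rw [MvPolynomial.eval_map, ← h']
  congr 1

/-- A large field is infinite. -/
theorem IsLargeField.infinite {K : Type*} [Field K] (hK : IsLargeField K) : Infinite K := by
  by_contra hinf
  have := not_infinite_iff_finite.1 hinf
  have := Fintype.ofFinite K
  let P : MvPolynomial (Fin 1) K := MvPolynomial.X 0 ^ Fintype.card K - MvPolynomial.X 0
  obtain ⟨y, -, hy⟩ := hK 1 ∅ {P} ⟨fun _ => HahnSeries.ofPowerSeries ℤ K PowerSeries.X, by simp, by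
    intro g hg
    rw [Finset.mem_singleton.1 hg]
    simp only [P, map_sub, map_pow, MvPolynomial.aeval_X]
    rw [← map_pow, ← map_sub, Ne, map_eq_zero_iff _ HahnSeries.ofPowerSeries_injective]
    intro h
    have h1 := congrArg (PowerSeries.coeff 1) h
    simp [PowerSeries.coeff_X_pow, Fintype.one_lt_card.ne] at h1⟩
  refine hy P (by simp) ?_
  simp [P, FiniteField.pow_card]

/-- If the nonzero elements of a subalgebra `A` with fraction field `F` are separated from zero
by homomorphisms to `L`, then solvability of systems over `K` in `F` implies solvability in `L`. -/
theorem exists_solution_of_algHom {K F L : Type*} [Field K] [Field F] [Field L] [Algebra K F]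
    [Algebra K L] (A : Subalgebra K F) (hfrac : ∀ x : F, ∃ a b : A, (b : F) ≠ 0 ∧ x = a / b)
    (hA : ∀ a : A, a ≠ 0 → ∃ φ : A →ₐ[K] L, φ a ≠ 0) {ι : Type*} [Finite ι]
    {E N : Finset (MvPolynomial ι K)} {x : ι → F}
    (hE : ∀ f ∈ E, MvPolynomial.aeval x f = 0) (hN : ∀ g ∈ N, MvPolynomial.aeval x g ≠ 0) :
    ∃ y : ι → L, (∀ f ∈ E, MvPolynomial.aeval y f = 0) ∧
      (∀ g ∈ N, MvPolynomial.aeval y g ≠ 0) := by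
  classical
  have := Fintype.ofFinite ι
  choose num den hden hnd using hfrac
  have hnd' : ∀ z, z * den z = num z := fun z => by
    conv_lhs => enter [1]; rw [hnd z]
    rw [div_mul_cancel₀ _ (hden z)]
  let z : F := ∏ g ∈ N, MvPolynomial.aeval x g
  have hz : z ≠ 0 := Finset.prod_ne_zero_iff.2 hN
  have hnumz : num z ≠ 0 := by
    intro h
    have h' := hnd' z
    rw [h] at h'
    exact mul_ne_zero hz (hden z) (by simpa using h')
  obtain ⟨φ, hφ⟩ := hA ((∏ i, den (x i)) * num z) (mul_ne_zero
    (Finset.prod_ne_zero_iff.2 fun i _ h => hden (x i) (by rw [h]; rfl)) hnumz)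
  rw [map_mul, map_prod] at hφ
  have hφden : ∀ i, φ (den (x i)) ≠ 0 := fun i =>
    Finset.prod_ne_zero_iff.1 (left_ne_zero_of_mul hφ) i (Finset.mem_univ i)
  let P : Ideal A := RingHom.ker (φ : A →+* L)
  have hP : P.IsPrime := RingHom.ker_isPrime _
  let S := Localization.AtPrime P
  have hPL : ∀ b : P.primeCompl, IsUnit (φ b) := fun b => isUnit_iff_ne_zero.2 b.2
  have hPF : ∀ b : P.primeCompl, IsUnit (A.val b) := fun b => isUnit_iff_ne_zero.2 fun h =>
    b.2 (by rw [Subtype.ext (a1 := (b : A)) (a2 := 0) h]; exact zero_mem P)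
  let toL : S →ₐ[K] L := IsLocalization.liftAlgHom hPL
  let toF : S →ₐ[K] F := IsLocalization.liftAlgHom hPF
  have htoL : ∀ b : A, toL (algebraMap A S b) = φ b := fun b => IsLocalization.lift_eq hPL b
  have htoF : ∀ b : A, toF (algebraMap A S b) = b := fun b => IsLocalization.lift_eq hPF b
  have hinj : Function.Injective toF := by
    refine (IsLocalization.lift_injective_iff hPF).2 fun b c => ?_
    rw [(IsLocalization.injective S P.primeCompl_le_nonZeroDivisors).eq_iff]
    exact Subtype.ext_iff
  let w : ι → S := fun i => IsLocalization.mk' S (num (x i)) (⟨den (x i), hφden i⟩ : P.primeCompl)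
  have hw : ∀ i, toF (w i) = x i := fun i => by
    refine mul_right_cancel₀ (hden (x i)) ?_
    rw [hnd', ← htoF, ← htoF, ← map_mul]
    exact congrArg toF (IsLocalization.mk'_spec S (num (x i)) (⟨_, hφden i⟩ : P.primeCompl))
  have haeval : ∀ f, toF (MvPolynomial.aeval w f) = MvPolynomial.aeval x f := fun f => by
    rw [← AlgHom.comp_apply, MvPolynomial.comp_aeval]
    simp only [hw]
  refine ⟨fun i => toL (w i), fun f hf => ?_, fun g hg h => ?_⟩
  · rw [← MvPolynomial.comp_aeval, AlgHom.comp_apply,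
      (map_eq_zero_iff toF hinj).1 ((haeval f).trans (hE f hf)), map_zero]
  · have hS : (∏ g ∈ N, MvPolynomial.aeval w g) * algebraMap A S (den z)
        = algebraMap A S (num z) := hinj (by
      rw [map_mul, map_prod, htoF, htoF, ← hnd']
      simp only [haeval, z])
    have hL := congrArg toL hS
    rw [map_mul, map_prod, htoL, htoL, Finset.prod_eq_zero hg, zero_mul] at hL
    · exact right_ne_zero_of_mul hφ hL.symm
    · rw [← AlgHom.comp_apply, MvPolynomial.comp_aeval]
      exact h

/-- The residue map of a `K`-rational place as a `K`-algebra homomorphism on a subalgebra of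
the valuation ring; it vanishes exactly on the center. -/
theorem IsKRationalPlace.exists_algHom {K F : Type*} [Field K] [Field F] [Algebra K F]
    {O : ValuationSubring F} (hO : IsKRationalPlace K F O) (A : Subalgebra K F)
    (h : ∀ a : A, (a : F) ∈ O) : ∃ ρ : A →ₐ[K] K, ∀ a, ρ a = 0 ↔
      a ∈ (IsLocalRing.maximalIdeal O).comap (subalgebraToValuationSubring A O h) := by
  obtain ⟨hK, hbij⟩ := hO
  let ι : K →+* IsLocalRing.ResidueField O := (IsLocalRing.residue O).comp
    ((algebraMap K F).codRestrict O.toSubring hK)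
  let e : K ≃+* IsLocalRing.ResidueField O := RingEquiv.ofBijective ι hbij
  let ρ : A →+* K := (e.symm : IsLocalRing.ResidueField O →+* K).comp
    ((IsLocalRing.residue O).comp (subalgebraToValuationSubring A O h))
  refine ⟨{ ρ with commutes' := fun k => ?_ }, fun a => ?_⟩
  · exact e.symm_apply_apply k
  · change e.symm (IsLocalRing.residue O (subalgebraToValuationSubring A O h a)) = 0 ↔ _
    rw [map_eq_zero_iff _ e.symm.injective, IsLocalRing.residue_eq_zero_iff, Ideal.mem_comap]

/-- **Kuhlmann (2004), Theorem 19.** Let `K` be a large field and `F|K` an algebraic function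
field. If there is a `K`-rational place of `F` which admits local uniformization, then `K` is
existentially closed in `F`. -/
theorem ec_of_rational_place_with_local_uniformization
    (K : Type*) [Field K] (F : Type*) [Field F] [Algebra K F]
    (hlarge : IsLargeField K) (hFF : IsFunctionField K F)
    (hplace : ∃ O : ValuationSubring F,
      IsKRationalPlace K F O ∧ AdmitsLocalUniformization K F O) :
    ExistentiallyClosedIn K F := by
  obtain ⟨O, hO, A, h, -, hfrac, hreg⟩ := hplace
  have := hlarge.infinite
  obtain ⟨ρ, hρ⟩ := hO.exists_algHom A h
  set P : Ideal A := (IsLocalRing.maximalIdeal O).comap (subalgebraToValuationSubring A O h)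
  have hPK : ∀ b : P.primeCompl, IsUnit (ρ b) := fun b =>
    isUnit_iff_ne_zero.2 fun h0 => b.2 ((hρ b).1 h0)
  intro n E N ⟨x, hE, hN⟩
  refine hlarge n E N (exists_solution_of_algHom A hfrac (fun a ha => ?_) hE hN)
  obtain ⟨φ, hφ⟩ := hreg.exists_algHom_powerSeries_ne_zero
    (IsLocalization.liftAlgHom (S := Localization.AtPrime P) hPK)
    ((map_ne_zero_iff _ (IsLocalization.injective _ P.primeCompl_le_nonZeroDivisors)).2 ha)
  let incl : PowerSeries K →ₐ[K] LaurentSeries K :=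
    { HahnSeries.ofPowerSeries ℤ K with commutes' := fun _ => rfl }
  refine ⟨(incl.comp φ).comp
    (IsScalarTower.toAlgHom K A (Localization.AtPrime P)), ?_⟩
  exact (map_ne_zero_iff _ HahnSeries.ofPowerSeries_injective).2 hφ
end
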